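/- arXiv:1309.5856 — 3 statements merged into one kernel-verified Lean document; each statement's English description precedes it below -/
import Mathlib

section
/- (One-dimensional Riesz–Sobolev inequality.) For any Lebesgue measurable sets A, B, C ⊆ ℝ with finite, positive Lebesgue measures, ⟨1_A∗1_B, 1_C⟩ ≤ ⟨1_{A⋆}∗1_{B⋆}, 1_{C⋆}⟩. In particular, when ||A|−|B|| ≤ |C| ≤ |A|+|B| the right-hand side equals |A|·|B| − (1/4)(|A|+|B|−|C|)², so that ⟨1_A∗1_B, 1_C⟩ ≤ |A|·|B| − (1/4)(|A|+|B|−|C|)². -/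
open MeasureTheory Set Pointwise

/-- Lebesgue measure of a set of reals, as a real number. -/
noncomputable def lm (S : Set ℝ) : ℝ := (MeasureTheory.volume S).toReal

/-- Convolution of indicator functions: `(1_A ∗ 1_B)(x) = ∫ 1_A(y) 1_B(x−y) dy`. -/
noncomputable def cv (A B : Set ℝ) (x : ℝ) : ℝ :=
  ∫ y, A.indicator (1 : ℝ → ℝ) y * B.indicator (1 : ℝ → ℝ) (x - y)

/-- The pairing `⟨1_A ∗ 1_B, 1_C⟩ = ∫ (1_A ∗ 1_B) · 1_C`. -/
noncomputable def pr (A B C : Set ℝ) : ℝ := ∫ x, cv A B x * C.indicator (1 : ℝ → ℝ) x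

/-- The symmetric rearrangement `S⋆`: the open interval centered at 0 with `|S⋆| = |S|`. -/
noncomputable def sstar (S : Set ℝ) : Set ℝ := Set.Ioo (-(lm S / 2)) (lm S / 2)

/-- The Riesz–Sobolev deficit `D(A,B,C) = ⟨1_{A⋆}∗1_{B⋆},1_{C⋆}⟩ − ⟨1_A∗1_B,1_C⟩`. -/
noncomputable def rsD (A B C : Set ℝ) : ℝ := pr (sstar A) (sstar B) (sstar C) - pr A B C

/-- The superlevel set `S_{A,B}(t) = {x : (1_A ∗ 1_B)(x) > t}`. -/
def slev (A B : Set ℝ) (t : ℝ) : Set ℝ := {x | cv A B x > t}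

/-- The KPRGT deficit `D′(A,B,τ) = (|A|−τ)(|B|−τ) − ∫_τ^∞ |S_{A,B}(t)| dt`. -/
noncomputable def kD (A B : Set ℝ) (τ : ℝ) : ℝ :=
  (lm A - τ) * (lm B - τ) - ∫ t in Set.Ioi τ, lm (slev A B t)

/-- `η`-strict admissibility of the ordered triple `(A,B,C)`:
`|X| + |Y| ≥ |Z| + η·max(|A|,|B|,|C|)` for every permutation `(X,Y,Z)` of `(A,B,C)`. -/
def adm (η : ℝ) (A B C : Set ℝ) : Prop :=
  lm A + lm B ≥ lm C + η * max (lm A) (max (lm B) (lm C)) ∧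
  lm A + lm C ≥ lm B + η * max (lm A) (max (lm B) (lm C)) ∧
  lm B + lm C ≥ lm A + η * max (lm A) (max (lm B) (lm C))

open Filter Topology ENNReal

/-- A set of finite Lebesgue measure is the image of an interval of the same length under a
strictly increasing measure-preserving map. -/
theorem exists_strictMonoOn_map_eq_restrict {A : Set ℝ} (hAf : volume A ≠ ⊤) :
    ∃ X : ℝ → ℝ, Measurable X ∧ StrictMonoOn X (Ioo 0 (lm A)) ∧
      (volume.restrict (Ioo 0 (lm A))).map X = volume.restrict A := by
  classical
  set μ : Measure ℝ := volume.restrict A with hμ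
  have : IsFiniteMeasure μ := ⟨by simpa [hμ] using hAf.lt_top⟩
  set F : ℝ → ℝ := fun y => μ.real (Iic y) with hF
  have Fmono : Monotone F := fun x y h => measureReal_mono (Iic_subset_Iic.2 h)
  have Flip : ∀ x y, x ≤ y → F y ≤ F x + (y - x) := by
    intro x y h
    have h1 : F y = F x + μ.real (Ioc x y) := by
      rw [hF]; dsimp only
      rw [← Iic_union_Ioc_eq_Iic h, measureReal_union _ measurableSet_Ioc]
      exact Set.disjoint_left.2 fun z hz hz' => not_lt.2 hz hz'.1
    have h2 : μ.real (Ioc x y) ≤ y - x := by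
      have h3 : μ (Ioc x y) ≤ ENNReal.ofReal (y - x) := by
        rw [← Real.volume_Ioc]; exact Measure.restrict_apply_le _ _
      exact ENNReal.toReal_le_of_le_ofReal (by linarith) h3
    linarith
  have Fcont : Continuous F := by
    refine (LipschitzWith.of_le_add_mul 1 (f := F) fun x y => ?_).continuous
    rw [Real.dist_eq, NNReal.coe_one, one_mul]
    rcases le_total x y with h | h
    · have := Fmono h; have := abs_nonneg (x - y); linarith
    · have := Flip _ _ h; have := le_abs_self (x - y); linarith
  have Ftop : Tendsto F atTop (𝓝 (lm A)) := by
    have h1 := tendsto_measure_Iic_atTop μ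
    have h2 : μ univ = volume A := by simp [hμ]
    rw [h2] at h1
    exact (ENNReal.tendsto_toReal hAf).comp h1
  have Fbot : Tendsto F atBot (𝓝 0) := by
    have h1 := tendsto_measure_iInter_atBot (μ := μ) (s := fun x : ℝ => Iic x)
      (fun _ => measurableSet_Iic.nullMeasurableSet) monotone_Iic ⟨0, measure_ne_top _ _⟩
    have h2 : (⋂ x : ℝ, Iic x) = ∅ := by
      ext z
      simp only [mem_iInter, mem_Iic, mem_empty_iff_false, iff_false, not_forall, not_le]
      exact ⟨z - 1, by linarith⟩
    rw [h2, measure_empty] at h1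
    exact (ENNReal.tendsto_toReal ENNReal.zero_ne_top).comp h1
  have Fle : ∀ y, F y ≤ lm A := fun y => Fmono.ge_of_tendsto Ftop y
  have hex : ∀ s ∈ Ioo 0 (lm A), ∃ y, F y = s := fun s hs =>
    mem_range_of_exists_le_of_exists_ge Fcont
      ((Fbot.eventually_le_const hs.1).exists) ((Ftop.eventually_const_le hs.2).exists)
  choose! G hG using hex
  set X : ℝ → ℝ := (Ioo 0 (lm A)).piecewise G 0 with hX
  have FX : ∀ s ∈ Ioo 0 (lm A), F (X s) = s := fun s hs => by
    rw [hX, piecewise_eq_of_mem _ _ _ hs, hG s hs]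
  have Xmono : StrictMonoOn X (Ioo 0 (lm A)) := by
    intro s hs s' hs' h
    by_contra! hcon
    have := Fmono hcon
    rw [FX s hs, FX s' hs'] at this
    linarith
  have Xmeas : Measurable X := by
    refine measurable_of_Iic fun y => ?_
    have : X ⁻¹' Iic y = (Ioo 0 (lm A) ∩ X ⁻¹' Iic y) ∪
        ((Ioo 0 (lm A))ᶜ ∩ {_s | (0 : ℝ) ≤ y}) := by
      ext s
      by_cases hs : s ∈ Ioo 0 (lm A)
      · simp only [mem_union, mem_inter_iff, hs, mem_compl_iff, true_and, not_true, false_and,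
          or_false]
      · simp only [mem_union, mem_inter_iff, hs, mem_compl_iff, not_false_eq_true, true_and,
          false_and, false_or, hX, mem_preimage, piecewise_eq_of_notMem _ _ _ hs, mem_Iic,
          Pi.zero_apply, mem_ofPred_eq]
    rw [this]
    refine MeasurableSet.union ?_ (measurableSet_Ioo.compl.inter (MeasurableSet.const _))
    refine Set.OrdConnected.measurableSet ⟨fun s hs s' hs' z hz => ?_⟩
    have hz' : z ∈ Ioo 0 (lm A) := ⟨hs.1.1.trans_le hz.1, hz.2.trans_lt hs'.1.2⟩
    exact ⟨hz', (Xmono.monotoneOn hz' hs'.1 hz.2).trans hs'.2⟩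
  refine ⟨X, Xmeas, Xmono, ?_⟩
  refine Measure.ext_of_Iic _ _ fun y => ?_
  rw [Measure.map_apply Xmeas measurableSet_Iic,
    Measure.restrict_apply (Xmeas measurableSet_Iic)]
  have hFy : μ (Iic y) = ENNReal.ofReal (F y) := by
    rw [hF]; exact (ofReal_measureReal).symm
  rw [hFy]
  apply le_antisymm
  · calc volume (X ⁻¹' Iic y ∩ Ioo 0 (lm A)) ≤ volume (Ioc 0 (F y)) := by
          refine measure_mono fun s hs => ⟨hs.2.1, ?_⟩
          rw [← FX s hs.2]; exact Fmono hs.1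
      _ = _ := by rw [Real.volume_Ioc, sub_zero]
  · calc ENNReal.ofReal (F y) = volume (Ioo 0 (F y)) := by rw [Real.volume_Ioo, sub_zero]
      _ ≤ _ := by
          refine measure_mono fun s hs => ?_
          have hs' : s ∈ Ioo 0 (lm A) := ⟨hs.1, hs.2.trans_le (Fle y)⟩
          refine ⟨?_, hs'⟩
          by_contra hcon
          have := Fmono (le_of_lt (not_le.1 hcon))
          rw [FX s hs'] at this
          exact absurd hs.2 (not_lt.2 this)

theorem cv_eq_measureReal {A B : Set ℝ} (hA : MeasurableSet A) (hB : MeasurableSet B) (x : ℝ) :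
    cv A B x = volume.real (A ∩ (fun y => x - y) ⁻¹' B) := by
  have hB' : MeasurableSet ((fun y => x - y) ⁻¹' B) := by
    exact (measurable_const.sub measurable_id) hB
  rw [cv, ← integral_indicator_one (hA.inter hB')]
  congr 1
  ext y
  by_cases h1 : y ∈ A <;> by_cases h2 : x - y ∈ B <;> simp [h1, h2]

theorem pr_eq_setIntegral {A B C : Set ℝ} (hC : MeasurableSet C) :
    pr A B C = ∫ x in C, cv A B x := by
  rw [pr, ← integral_indicator hC]
  congr 1
  ext x
  by_cases h : x ∈ C <;> simp [h]

theorem pr_eq_lintegral {A B C : Set ℝ} (hA : MeasurableSet A) (hB : MeasurableSet B)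
    (hC : MeasurableSet C) (hAf : volume A ≠ ⊤) :
    pr A B C = (∫⁻ y in A, volume.restrict (-B) ((fun z => y - z) ⁻¹' C)).toReal := by
  have hmeas : MeasurableSet {p : ℝ × ℝ | p.1 - p.2 ∈ B} := (measurable_fst.sub measurable_snd) hB
  have hsec : ∀ x : ℝ, MeasurableSet ((fun y => x - y) ⁻¹' B) := fun x =>
    (measurable_const.sub measurable_id) hB
  have key : ∀ x, cv A B x = (volume.restrict A ((fun y => x - y) ⁻¹' B)).toReal := fun x => by
    rw [cv_eq_measureReal hA hB, Measure.restrict_apply (hsec x), inter_comm]; rfl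
  simp_rw [pr_eq_setIntegral hC, key]
  have : IsFiniteMeasure (volume.restrict A) := ⟨by simpa using hAf.lt_top⟩
  have hsecm : Measurable fun x => volume.restrict A ((fun y => x - y) ⁻¹' B) :=
    measurable_measure_prodMk_left hmeas
  rw [integral_toReal hsecm.aemeasurable
    (Eventually.of_forall fun x => measure_lt_top _ _)]
  congr 1
  calc ∫⁻ x in C, volume.restrict A ((fun y => x - y) ⁻¹' B)
      = ∫⁻ x in C, ∫⁻ y in A, {p : ℝ × ℝ | p.1 - p.2 ∈ B}.indicator 1 (x, y) := by
        refine lintegral_congr fun x => ?_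
        rw [← lintegral_indicator_one (hsec x)]
        rfl
    _ = ∫⁻ y in A, ∫⁻ x in C, {p : ℝ × ℝ | p.1 - p.2 ∈ B}.indicator 1 (x, y) :=
        lintegral_lintegral_swap (measurable_one.indicator hmeas).aemeasurable
    _ = _ := by
        refine lintegral_congr fun y => ?_
        have h1 : MeasurableSet ((fun x => x - y) ⁻¹' B) := (measurable_id.sub_const y) hB
        have h2 : MeasurableSet ((fun z => y - z) ⁻¹' C) :=
          (measurable_const.sub measurable_id) hC
        calc ∫⁻ x in C, {p : ℝ × ℝ | p.1 - p.2 ∈ B}.indicator 1 (x, y)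
            = ∫⁻ x in C, ((fun x => x - y) ⁻¹' B).indicator 1 x := rfl
          _ = volume (((fun x => x - y) ⁻¹' B) ∩ C) := by
            rw [lintegral_indicator_one h1, Measure.restrict_apply h1]
          _ = volume ((fun z => y - z) ⁻¹' (((fun x => x - y) ⁻¹' B) ∩ C)) :=
            ((Measure.measurePreserving_sub_left volume y).measure_preimage
              (h1.inter hC).nullMeasurableSet).symm
          _ = _ := by
            rw [Measure.restrict_apply h2, inter_comm]
            congr 1
            ext z
            simp

/-- Hook decomposition of a rectangle for the difference of two increasing rearrangements. -/
theorem lintegral_restrict_sub_preimage_le {A B C : Set ℝ} (hC : MeasurableSet C)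
    (hAf : volume A ≠ ⊤) (hBf : volume B ≠ ⊤) {t : ℝ}
    (hta : t ≤ lm A) (htb : t ≤ lm B) :
    ∫⁻ y in A, volume.restrict B ((fun z => y - z) ⁻¹' C) ≤
      ENNReal.ofReal t * volume C + ENNReal.ofReal ((lm A - t) * (lm B - t)) := by
  obtain ⟨X, hXm, hXs, hX⟩ := exists_strictMonoOn_map_eq_restrict hAf
  obtain ⟨Y, hYm, hYs, hY⟩ := exists_strictMonoOn_map_eq_restrict hBf
  set a := lm A
  set b := lm B
  have hsec : ∀ y : ℝ, MeasurableSet ((fun z => y - z) ⁻¹' C) := fun y =>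
    (measurable_const.sub measurable_id) hC
  have hpair : MeasurableSet {p : ℝ × ℝ | p.1 - p.2 ∈ C} := (measurable_fst.sub measurable_snd) hC
  have : IsFiniteMeasure (volume.restrict B) := ⟨by simpa using hBf.lt_top⟩
  have h0 : ∫⁻ y in A, volume.restrict B ((fun z => y - z) ⁻¹' C) =
      ∫⁻ u in Ioo 0 a, volume.restrict (Ioo 0 b) {v | X u - Y v ∈ C} := by
    have hsecm : Measurable fun y => volume.restrict B ((fun z => y - z) ⁻¹' C) :=
      measurable_measure_prodMk_left hpair
    rw [← hX, lintegral_map hsecm hXm]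
    refine lintegral_congr fun u => ?_
    rw [← hY, Measure.map_apply hYm (hsec _)]
    rfl
  set H : Set (ℝ × ℝ) := {p | X p.1 - Y p.2 ∈ C} with hH
  have hHm : MeasurableSet H := ((hXm.comp measurable_fst).sub (hYm.comp measurable_snd)) hC
  have hHu : ∀ u, MeasurableSet {v | X u - Y v ∈ C} := fun u => (measurable_const.sub hYm) hC
  have hHv : ∀ v, MeasurableSet {u | X u - Y v ∈ C} := fun v => (hXm.sub_const _) hC
  set V : ℝ → ℝ≥0∞ := fun s => volume.restrict (Ioo 0 b) {v | s < v ∧ X s - Y v ∈ C} with hV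
  set U : ℝ → ℝ≥0∞ := fun s => volume.restrict (Ioo 0 a) {u | s ≤ u ∧ X u - Y s ∈ C} with hU
  have hVm : Measurable V := by
    have : MeasurableSet {p : ℝ × ℝ | p.1 < p.2 ∧ p ∈ H} :=
      (measurableSet_lt measurable_fst measurable_snd).inter hHm
    exact measurable_measure_prodMk_left this
  have hK : MeasurableSet {p : ℝ × ℝ | p.2 ≤ p.1 ∧ p ∈ H} :=
    (measurableSet_le measurable_snd measurable_fst).inter hHm
  have hWm : Measurable fun u => volume.restrict (Ioo 0 t) {v | v ≤ u ∧ X u - Y v ∈ C} :=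
    measurable_measure_prodMk_left hK
  have hVle : ∀ s ∈ Ioo 0 t, V s ≤ volume (C ∩ Iio (X s - Y s)) := by
    intro s hs
    have hsb : s ∈ Ioo 0 b := ⟨hs.1, hs.2.trans_le htb⟩
    set E : Set ℝ := (fun z => X s - z) ⁻¹' (C ∩ Iio (X s - Y s)) with hE
    have hEm : MeasurableSet E := (measurable_const.sub measurable_id) (hC.inter measurableSet_Iio)
    calc V s ≤ volume.restrict (Ioo 0 b) (Y ⁻¹' E) := by
          simp only [hV]
          rw [Measure.restrict_apply' measurableSet_Ioo, Measure.restrict_apply' measurableSet_Ioo]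
          refine measure_mono fun v hv => ⟨⟨hv.1.2, ?_⟩, hv.2⟩
          have := hYs hsb hv.2 hv.1.1
          simp only [mem_Iio]; linarith
      _ = volume.restrict B E := by rw [← hY, Measure.map_apply hYm hEm]
      _ ≤ volume E := Measure.restrict_apply_le _ _
      _ = _ := (Measure.measurePreserving_sub_left volume (X s)).measure_preimage
          (hC.inter measurableSet_Iio).nullMeasurableSet
  have hUle : ∀ s ∈ Ioo 0 t, U s ≤ volume (C ∩ Ici (X s - Y s)) := by
    intro s hs
    have hsa : s ∈ Ioo 0 a := ⟨hs.1, hs.2.trans_le hta⟩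
    set E : Set ℝ := (fun y => y - Y s) ⁻¹' (C ∩ Ici (X s - Y s)) with hE
    have hEm : MeasurableSet E := (measurable_id.sub_const _) (hC.inter measurableSet_Ici)
    calc U s ≤ volume.restrict (Ioo 0 a) (X ⁻¹' E) := by
          simp only [hU]
          rw [Measure.restrict_apply' measurableSet_Ioo, Measure.restrict_apply' measurableSet_Ioo]
          refine measure_mono fun u hu => ⟨⟨hu.1.2, ?_⟩, hu.2⟩
          have := hXs.monotoneOn hsa hu.2 hu.1.1
          simp only [mem_Ici]; linarith
      _ = volume.restrict A E := by rw [← hX, Measure.map_apply hXm hEm]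
      _ ≤ volume E := Measure.restrict_apply_le _ _
      _ = _ := (measurePreserving_sub_right volume (Y s)).measure_preimage
          (hC.inter measurableSet_Ici).nullMeasurableSet
  have hsplit : ∀ u ∈ Ioo 0 a, volume.restrict (Ioo 0 b) {v | X u - Y v ∈ C} ≤
      ((Iio t).indicator V u + volume.restrict (Ioo 0 t) {v | v ≤ u ∧ X u - Y v ∈ C}) +
        (Ici t).indicator (fun _ => ENNReal.ofReal (b - t)) u := by
    intro u hu
    rcases lt_or_ge u t with hut | hut
    · rw [indicator_of_mem (show u ∈ Iio t from hut),
        indicator_of_notMem (show u ∉ Ici t from not_le.2 hut), add_zero]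
      simp only [hV]
      simp only [Measure.restrict_apply' measurableSet_Ioo]
      refine (measure_mono fun v hv => ?_).trans (measure_union_le _ _)
      rcases lt_or_ge u v with h | h
      · exact Or.inl ⟨⟨h, hv.1⟩, hv.2⟩
      · exact Or.inr ⟨⟨h, hv.1⟩, hv.2.1, h.trans_lt hut⟩
    · rw [indicator_of_notMem (show u ∉ Iio t from not_lt.2 hut), zero_add,
        indicator_of_mem (show u ∈ Ici t from hut), ← Real.volume_Ico]
      simp only [Measure.restrict_apply' measurableSet_Ioo]
      refine (measure_mono fun v hv => ?_).trans (measure_union_le _ _)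
      rcases lt_or_ge v t with h | h
      · exact Or.inl ⟨⟨h.le.trans hut, hv.1⟩, hv.2.1, h⟩
      · exact Or.inr ⟨h, hv.2.2⟩
  have hswap : ∫⁻ u in Ioo 0 a, volume.restrict (Ioo 0 t) {v | v ≤ u ∧ X u - Y v ∈ C} =
      ∫⁻ s in Ioo 0 t, U s := by
    calc _ = ∫⁻ u in Ioo 0 a, ∫⁻ v in Ioo 0 t,
          {p : ℝ × ℝ | p.2 ≤ p.1 ∧ p ∈ H}.indicator 1 (u, v) := by
          refine lintegral_congr fun u => ?_
          have hm : MeasurableSet {v | v ≤ u ∧ X u - Y v ∈ C} :=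
            measurableSet_Iic.inter (hHu u)
          rw [← lintegral_indicator_one hm]
          rfl
      _ = ∫⁻ v in Ioo 0 t, ∫⁻ u in Ioo 0 a,
          {p : ℝ × ℝ | p.2 ≤ p.1 ∧ p ∈ H}.indicator 1 (u, v) :=
          lintegral_lintegral_swap (measurable_one.indicator hK).aemeasurable
      _ = _ := by
          refine lintegral_congr fun v => ?_
          simp only [hU]
          have hm : MeasurableSet {u | v ≤ u ∧ X u - Y v ∈ C} :=
            measurableSet_Ici.inter (hHv v)
          rw [← lintegral_indicator_one hm]
          rfl
  have hfirst : ∫⁻ u in Ioo 0 a, (Iio t).indicator V u = ∫⁻ s in Ioo 0 t, V s := by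
    rw [lintegral_indicator measurableSet_Iio, Measure.restrict_restrict measurableSet_Iio]
    congr 2
    ext s
    simp only [mem_inter_iff, mem_Iio, mem_Ioo]
    constructor
    · rintro ⟨h1, h2, -⟩; exact ⟨h2, h1⟩
    · rintro ⟨h1, h2⟩; exact ⟨h2, h1, h2.trans_le hta⟩
  have hlast : ∫⁻ u in Ioo 0 a, (Ici t).indicator (fun _ => ENNReal.ofReal (b - t)) u ≤
      ENNReal.ofReal ((a - t) * (b - t)) := by
    rw [lintegral_indicator measurableSet_Ici, Measure.restrict_restrict measurableSet_Ici,
      setLIntegral_const, mul_comm, ENNReal.ofReal_mul (sub_nonneg.2 hta)]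
    have hsub : Ici t ∩ Ioo 0 a ⊆ Ico t a := fun s hs => ⟨hs.1, hs.2.2⟩
    gcongr
    exact (measure_mono hsub).trans_eq Real.volume_Ico
  rw [h0]
  calc _ ≤ ∫⁻ u in Ioo 0 a,
        (((Iio t).indicator V u + volume.restrict (Ioo 0 t) {v | v ≤ u ∧ X u - Y v ∈ C}) +
        (Ici t).indicator (fun _ => ENNReal.ofReal (b - t)) u) :=
        setLIntegral_mono' measurableSet_Ioo hsplit
    _ = (∫⁻ s in Ioo 0 t, (V s + U s)) +
        ∫⁻ u in Ioo 0 a, (Ici t).indicator (fun _ => ENNReal.ofReal (b - t)) u := by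
        have hsum : Measurable fun u =>
            (Iio t).indicator V u + volume.restrict (Ioo 0 t) {v | v ≤ u ∧ X u - Y v ∈ C} :=
          (hVm.indicator measurableSet_Iio).add hWm
        rw [lintegral_add_left hsum,
          lintegral_add_left (hVm.indicator measurableSet_Iio), hfirst, hswap,
          lintegral_add_left hVm]
    _ ≤ (∫⁻ s in Ioo 0 t, volume C) + ENNReal.ofReal ((a - t) * (b - t)) := by
        refine add_le_add (setLIntegral_mono' measurableSet_Ioo fun s hs => ?_) hlast
        refine (add_le_add (hVle s hs) (hUle s hs)).trans ?_
        have := measure_inter_add_sdiff (μ := volume) C (measurableSet_Iio (a := X s - Y s))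
        rw [Set.sdiff_eq, compl_Iio] at this
        exact this.le
    _ = _ := by rw [setLIntegral_const, Real.volume_Ioo, sub_zero, mul_comm]

/-- The family of linear bounds whose minimum over `t` is the Riesz–Sobolev bound. -/
theorem pr_le_mul_add_mul {A B C : Set ℝ} (hA : MeasurableSet A) (hB : MeasurableSet B)
    (hC : MeasurableSet C) (hAf : volume A ≠ ⊤) (hBf : volume B ≠ ⊤) (hCf : volume C ≠ ⊤)
    {t : ℝ} (ht0 : 0 ≤ t) (hta : t ≤ lm A) (htb : t ≤ lm B) :
    pr A B C ≤ t * lm C + (lm A - t) * (lm B - t) := by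
  have hneg : lm (-B) = lm B := by simp [lm, Measure.measure_neg]
  have hBf' : volume (-B) ≠ ⊤ := by rwa [Measure.measure_neg]
  have key := lintegral_restrict_sub_preimage_le hC hAf hBf' hta (htb.trans_eq hneg.symm)
  rw [pr_eq_lintegral hA hB hC hAf]
  have hn : 0 ≤ t * lm C := mul_nonneg ht0 ENNReal.toReal_nonneg
  have hn' : 0 ≤ (lm A - t) * (lm B - t) := mul_nonneg (sub_nonneg.2 hta) (sub_nonneg.2 htb)
  refine ENNReal.toReal_le_of_le_ofReal (add_nonneg hn hn') ?_
  rw [ENNReal.ofReal_add hn hn', ENNReal.ofReal_mul ht0]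
  rw [hneg] at key
  rwa [lm, ENNReal.ofReal_toReal hCf]

theorem cv_nonneg (A B : Set ℝ) (x : ℝ) : 0 ≤ cv A B x :=
  integral_nonneg fun _ => mul_nonneg (indicator_nonneg (fun _ _ => zero_le_one) _)
    (indicator_nonneg (fun _ _ => zero_le_one) _)

theorem cv_sstar_eq (A B : Set ℝ) (x : ℝ) :
    cv (sstar A) (sstar B) x =
      max 0 ((lm A + lm B) / 2 - max (|lm A - lm B| / 2) |x|) := by
  have ha : 0 ≤ lm A := ENNReal.toReal_nonneg
  have hb : 0 ≤ lm B := ENNReal.toReal_nonneg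
  rw [sstar, sstar, cv_eq_measureReal measurableSet_Ioo measurableSet_Ioo,
    Set.preimage_const_sub_Ioo, Ioo_inter_Ioo, Measure.real, Real.volume_Ioo,
    ENNReal.toReal_ofReal', max_comm]
  congr 1
  grind

theorem integral_sub_max_abs_of_le {S D r : ℝ} (hr : 0 ≤ r) (hrD : r ≤ D) :
    ∫ x in (-r)..r, (S - max D |x|) = 2 * r * (S - D) := by
  have h : EqOn (fun x => S - max D |x|) (fun _ => S - D) (uIcc (-r) r) := by
    intro x hx
    rw [uIcc_of_le (by linarith)] at hx
    simp only [max_eq_left ((abs_le.2 hx).trans hrD)]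
  rw [intervalIntegral.integral_congr h, intervalIntegral.integral_const, smul_eq_mul]
  ring

theorem integral_sub_max_abs_of_ge {S D r : ℝ} (hD : 0 ≤ D) (hDr : D ≤ r) :
    ∫ x in (-r)..r, (S - max D |x|) = 2 * S * r - D ^ 2 - r ^ 2 := by
  have hint : ∀ p q : ℝ, IntervalIntegrable (fun x => S - max D |x|) volume p q := fun p q =>
    (by fun_prop : Continuous fun x : ℝ => S - max D |x|).intervalIntegrable p q
  have hl : ∫ x in (-r)..(-D), (S - max D |x|) = ∫ x in (-r)..(-D), (S + x) := by
    refine intervalIntegral.integral_congr fun x hx => ?_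
    rw [uIcc_of_le (by linarith)] at hx
    simp only [abs_of_nonpos (show x ≤ 0 by linarith [hx.2]),
      max_eq_right (show D ≤ -x by linarith [hx.2])]
    ring
  have hr : ∫ x in D..r, (S - max D |x|) = ∫ x in D..r, (S - x) := by
    refine intervalIntegral.integral_congr fun x hx => ?_
    rw [uIcc_of_le hDr] at hx
    simp only [abs_of_nonneg (hD.trans hx.1), max_eq_right hx.1]
  rw [← intervalIntegral.integral_add_adjacent_intervals (hint (-r) (-D)) (hint (-D) r),
    ← intervalIntegral.integral_add_adjacent_intervals (hint (-D) D) (hint D r),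
    integral_sub_max_abs_of_le hD le_rfl, hl, hr,
    intervalIntegral.integral_add (by simp) (by simp),
    intervalIntegral.integral_sub (by simp) (by simp)]
  simp only [intervalIntegral.integral_const, integral_id, smul_eq_mul]
  ring

theorem integral_sub_max_abs_le_pr_sstar (A B C : Set ℝ) {r : ℝ} (hr : 0 ≤ r)
    (hrC : r ≤ lm C / 2) :
    ∫ x in (-r)..r, ((lm A + lm B) / 2 - max (|lm A - lm B| / 2) |x|) ≤
      pr (sstar A) (sstar B) (sstar C) := by
  have hcont : Continuous (cv (sstar A) (sstar B)) := by
    rw [funext (cv_sstar_eq A B)]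
    fun_prop
  have hpr : pr (sstar A) (sstar B) (sstar C) =
      ∫ x in (-(lm C / 2))..(lm C / 2), cv (sstar A) (sstar B) x := by
    rw [sstar.eq_1 C, pr_eq_setIntegral measurableSet_Ioo,
      intervalIntegral.integral_of_le (by linarith), integral_Ioc_eq_integral_Ioo]
  rw [hpr]
  calc _ ≤ ∫ x in (-r)..r, cv (sstar A) (sstar B) x := by
        refine intervalIntegral.integral_mono_on (by linarith)
          (Continuous.intervalIntegrable (by fun_prop) _ _) (hcont.intervalIntegrable _ _)
          fun x _ => ?_
        rw [cv_sstar_eq]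
        exact le_max_right _ _
    _ ≤ _ := intervalIntegral.integral_mono_interval (by linarith) (by linarith) hrC
        (Eventually.of_forall fun x => cv_nonneg _ _ x) (hcont.intervalIntegrable _ _)

/-- The one-dimensional Riesz–Sobolev inequality. -/
theorem riesz_sobolev_one_dim (A B C : Set ℝ)
    (hA : MeasurableSet A) (hB : MeasurableSet B) (hC : MeasurableSet C)
    (hA0 : 0 < volume A) (hAf : volume A ≠ ⊤)
    (hB0 : 0 < volume B) (hBf : volume B ≠ ⊤)
    (hC0 : 0 < volume C) (hCf : volume C ≠ ⊤) :
    pr A B C ≤ pr (sstar A) (sstar B) (sstar C) ∧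
    (|lm A - lm B| ≤ lm C → lm C ≤ lm A + lm B →
      pr A B C ≤ lm A * lm B - (1/4) * (lm A + lm B - lm C)^2) := by
  have ha : 0 ≤ lm A := ENNReal.toReal_nonneg
  have hb : 0 ≤ lm B := ENNReal.toReal_nonneg
  have hc : 0 ≤ lm C := ENNReal.toReal_nonneg
  have hle : ∀ {t : ℝ}, 0 ≤ t → t ≤ lm A → t ≤ lm B →
      pr A B C ≤ t * lm C + (lm A - t) * (lm B - t) :=
    pr_le_mul_add_mul hA hB hC hAf hBf hCf
  have hmid : |lm A - lm B| ≤ lm C → lm C ≤ lm A + lm B →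
      pr A B C ≤ lm A * lm B - (1/4) * (lm A + lm B - lm C)^2 := by
    intro h1 h2
    obtain ⟨h3, h4⟩ := abs_le.1 h1
    refine (hle (t := (lm A + lm B - lm C) / 2) (by linarith) (by linarith)
      (by linarith)).trans_eq ?_
    ring
  refine ⟨?_, hmid⟩
  have hD : (|lm A - lm B| / 2) ^ 2 = (lm A - lm B) ^ 2 / 4 := by
    rw [div_pow, sq_abs]; norm_num
  have hD0 : 0 ≤ |lm A - lm B| / 2 := by positivity
  rcases le_total (lm C) |lm A - lm B| with h1 | h1
  · have hlow := integral_sub_max_abs_le_pr_sstar A B C (by linarith : 0 ≤ lm C / 2) le_rfl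
    rw [integral_sub_max_abs_of_le (by linarith) (by linarith)] at hlow
    refine le_trans ?_ hlow
    rcases le_total (lm A) (lm B) with h | h
    · refine (hle ha le_rfl h).trans_eq ?_
      rw [abs_of_nonpos (by linarith)]
      ring
    · refine (hle hb h le_rfl).trans_eq ?_
      rw [abs_of_nonneg (by linarith)]
      ring
  rcases le_total (lm C) (lm A + lm B) with h2 | h2
  · have hlow := integral_sub_max_abs_le_pr_sstar A B C (by linarith : 0 ≤ lm C / 2) le_rfl
    rw [integral_sub_max_abs_of_ge hD0 (by linarith), hD] at hlow
    refine (hmid h1 h2).trans (le_trans (le_of_eq ?_) hlow)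
    ring
  · have hlow := integral_sub_max_abs_le_pr_sstar A B C
      (by linarith : 0 ≤ (lm A + lm B) / 2) (by linarith)
    have habs : |lm A - lm B| ≤ lm A + lm B := abs_le.2 ⟨by linarith, by linarith⟩
    rw [integral_sub_max_abs_of_ge hD0 (by linarith), hD] at hlow
    refine (hle le_rfl ha hb).trans (le_trans (le_of_eq ?_) hlow)
    ring
end

section
/- Let A, B, E ⊆ ℝ be Lebesgue measurable sets with finite, positive measures, let D = D(A,B,E) be the Riesz–Sobolev deficit, and suppose ||A|−|B|| + 2D^{1/2} < |E| < |A| + |B| − 2D^{1/2}. Define τ by |E| = |A| + |B| − 2τ. Then the superlevel set S_{A,B}(τ) satisfies D(A, B, S_{A,B}(τ)) ≤ D(A, B, E). -/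
open MeasureTheory Set Pointwise

lemma integrable_cv {A B : Set ℝ} (hA : MeasurableSet A) (hB : MeasurableSet B)
    (hAf : volume A ≠ ⊤) (hBf : volume B ≠ ⊤) : Integrable (cv A B) volume := by
  have hiA : Integrable (A.indicator (1 : ℝ → ℝ)) volume :=
    (integrableOn_const (C := (1 : ℝ)) hAf).integrable_indicator hA
  have hiB : Integrable (B.indicator (1 : ℝ → ℝ)) volume :=
    (integrableOn_const (C := (1 : ℝ)) hBf).integrable_indicator hB
  exact hiA.integrable_convolution (ContinuousLinearMap.mul ℝ ℝ) hiB

/-- The bathtub principle: a set squeezed between `{f > t}` and `{f ≥ t}` maximizes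
`S ↦ ∫ f · 1_S - t |S|`. -/
lemma integral_mul_indicator_sub_le {f : ℝ → ℝ} (hf : Integrable f volume) {t : ℝ} {S E : Set ℝ}
    (hS : NullMeasurableSet S volume) (hE : NullMeasurableSet E volume)
    (hSf : volume S ≠ ⊤) (hEf : volume E ≠ ⊤)
    (hin : ∀ x ∈ E, t ≤ f x) (hout : ∀ x ∉ E, f x ≤ t) :
    (∫ x, f x * S.indicator (1 : ℝ → ℝ) x) - t * lm S ≤
      (∫ x, f x * E.indicator (1 : ℝ → ℝ) x) - t * lm E := by
  have hind : ∀ T : Set ℝ, NullMeasurableSet T volume → volume T ≠ ⊤ →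
      Integrable (fun x => (f x - t) * T.indicator (1 : ℝ → ℝ) x) volume ∧
      (∫ x, f x * T.indicator (1 : ℝ → ℝ) x) - t * lm T =
        ∫ x, (f x - t) * T.indicator (1 : ℝ → ℝ) x := by
    intro T hT hTf
    have hone : Integrable (T.indicator (1 : ℝ → ℝ)) volume :=
      (integrableOn_const (C := (1 : ℝ)) hTf).integrable_indicator₀ hT
    have hmul : Integrable (fun x => f x * T.indicator (1 : ℝ → ℝ) x) volume := by
      refine (hf.indicator₀ hT).congr (ae_of_all _ fun x => ?_)
      by_cases hx : x ∈ T <;> simp [hx]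
    have hval : ∫ x, T.indicator (1 : ℝ → ℝ) x = lm T := by
      rw [integral_indicator₀ hT]
      simp [lm, Measure.real]
    simp only [sub_mul]
    refine ⟨hmul.sub (hone.const_mul t), ?_⟩
    rw [integral_sub hmul (hone.const_mul t), integral_const_mul, hval]
  rw [(hind S hS hSf).2, (hind E hE hEf).2]
  refine integral_mono (hind S hS hSf).1 (hind E hE hEf).1 fun x => ?_
  by_cases hxE : x ∈ E
  · have := hin x hxE
    by_cases hxS : x ∈ S <;> simp [hxE, hxS, this]
  · have := hout x hxE
    by_cases hxS : x ∈ S <;> simp [hxE, hxS, this]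

lemma lm_nonneg (S : Set ℝ) : 0 ≤ lm S := ENNReal.toReal_nonneg

lemma volume_sstar_ne_top (S : Set ℝ) : volume (sstar S) ≠ ⊤ := by
  simp [sstar]

lemma lm_sstar (S : Set ℝ) : lm (sstar S) = lm S := by
  have h : lm S / 2 - -(lm S / 2) = lm S := by ring
  rw [lm, sstar, Real.volume_Ioo, h, ENNReal.toReal_ofReal (lm_nonneg S)]

lemma cv_sstar (A B : Set ℝ) (x : ℝ) :
    cv (sstar A) (sstar B) x =
      max (min (lm A / 2) (x + lm B / 2) - max (-(lm A / 2)) (x - lm B / 2)) 0 := by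
  have h : (fun y => (sstar A).indicator (1 : ℝ → ℝ) y * (sstar B).indicator (1 : ℝ → ℝ) (x - y)) =
      (Ioo (max (-(lm A / 2)) (x - lm B / 2)) (min (lm A / 2) (x + lm B / 2))).indicator 1 := by
    rw [← Ioo_inter_Ioo, inter_indicator_one]
    funext y
    simp only [sstar, Pi.mul_apply, indicator_apply, mem_Ioo]
    congr 1
    refine if_congr ?_ rfl rfl
    constructor <;> rintro ⟨h₁, h₂⟩ <;> constructor <;> linarith
  rw [cv, h, integral_indicator_one measurableSet_Ioo, measureReal_def, Real.volume_Ioo,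
    ENNReal.toReal_ofReal']

/-- Replacing `E` by the superlevel set of the same nominal measure does not
increase the Riesz–Sobolev deficit. -/
theorem deficit_superlevel_le (A B E : Set ℝ)
    (hA : MeasurableSet A) (hB : MeasurableSet B) (hE : MeasurableSet E)
    (hA0 : 0 < volume A) (hAf : volume A ≠ ⊤)
    (hB0 : 0 < volume B) (hBf : volume B ≠ ⊤)
    (hE0 : 0 < volume E) (hEf : volume E ≠ ⊤)
    (hlo : |lm A - lm B| + 2 * Real.sqrt (rsD A B E) < lm E)
    (hhi : lm E < lm A + lm B - 2 * Real.sqrt (rsD A B E))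
    (τ : ℝ) (hτ : lm E = lm A + lm B - 2*τ) :
    rsD A B (slev A B τ) ≤ rsD A B E := by
  have hsqrt := Real.sqrt_nonneg (rsD A B E)
  have hτ0 : 0 < τ := by linarith
  have hτA : τ ≤ lm A := by linarith [neg_abs_le (lm A - lm B)]
  have hτB : τ ≤ lm B := by linarith [le_abs_self (lm A - lm B)]
  have hf := integrable_cv hA hB hAf hBf
  have hSm : NullMeasurableSet (slev A B τ) volume :=
    nullMeasurableSet_lt aemeasurable_const hf.aemeasurable
  have hSf : volume (slev A B τ) ≠ ⊤ := (hf.measure_gt_lt_top hτ0).ne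
  have hlevel := integral_mul_indicator_sub_le hf (t := τ) hE.nullMeasurableSet hSm hEf hSf
    (fun x hx => le_of_lt hx) (fun x hx => not_lt.mp hx)
  have hmstar : ∀ T : Set ℝ, MeasurableSet (sstar T) := fun T => measurableSet_Ioo
  have hstar := integral_mul_indicator_sub_le
    (integrable_cv (hmstar A) (hmstar B) (volume_sstar_ne_top A) (volume_sstar_ne_top B))
    (t := τ) (S := sstar (slev A B τ)) (E := sstar E)
    (hmstar _).nullMeasurableSet (hmstar _).nullMeasurableSet
    (volume_sstar_ne_top _) (volume_sstar_ne_top _)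
    (by
      rintro x ⟨hx₁, hx₂⟩
      rw [cv_sstar]
      refine le_max_of_le_left ?_
      rw [le_sub_iff_add_le, ← le_sub_iff_add_le']
      refine max_le ?_ ?_ <;> rw [le_sub_iff_add_le'] <;>
        refine le_min ?_ ?_ <;> linarith)
    (by
      intro x hx
      rw [cv_sstar]
      refine max_le ?_ hτ0.le
      have h₁ := min_le_left (lm A / 2) (x + lm B / 2)
      have h₂ := min_le_right (lm A / 2) (x + lm B / 2)
      have h₃ := le_max_left (-(lm A / 2)) (x - lm B / 2)
      have h₄ := le_max_right (-(lm A / 2)) (x - lm B / 2)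
      by_cases h : -(lm E / 2) < x
      · have : lm E / 2 ≤ x := not_lt.mp fun h' => hx ⟨h, h'⟩
        linarith
      · linarith)
  rw [lm_sstar, lm_sstar] at hstar
  simp only [rsD, pr]
  linarith
end

section
/- Let U, V ⊆ ℝ^d be Lebesgue measurable sets with finite Lebesgue measures, and let α₁, α₂ > 0. Then S_{U,V}(α₁) − S_{U,V}(α₂) ⊆ S_{U,−U}(α₁ + α₂ − |V|), where X − Y = {x − y : x ∈ X, y ∈ Y} denotes the difference set. -/
open MeasureTheory Set Pointwise

/-- Convolution of indicator functions on `ℝ^d`. -/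
noncomputable def cvE {d : ℕ} (U V : Set (EuclideanSpace ℝ (Fin d)))
    (x : EuclideanSpace ℝ (Fin d)) : ℝ :=
  ∫ y, U.indicator (1 : EuclideanSpace ℝ (Fin d) → ℝ) y
      * V.indicator (1 : EuclideanSpace ℝ (Fin d) → ℝ) (x - y)

/-- Superlevel set `S_{U,V}(α) = {x : (1_U ∗ 1_V)(x) > α}` in `ℝ^d`. -/
def slevE {d : ℕ} (U V : Set (EuclideanSpace ℝ (Fin d))) (α : ℝ) :
    Set (EuclideanSpace ℝ (Fin d)) :=
  {x | cvE U V x > α}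

/-- The convolution of two indicators as an integral of an indicator of an intersection,
after the change of variables `y = a - v`. -/
theorem cvE_eq_integral_indicator_inter {d : ℕ} (U V : Set (EuclideanSpace ℝ (Fin d)))
    (a x : EuclideanSpace ℝ (Fin d)) :
    cvE U V x = ∫ v, (((a - ·) ⁻¹' U) ∩ ((fun v => x - (a - v)) ⁻¹' V)).indicator
      (1 : EuclideanSpace ℝ (Fin d) → ℝ) v := by
  unfold cvE
  rw [← integral_sub_left_eq_self _ volume a]
  congr 1 with v
  rw [inter_indicator_one]
  rfl

/-- A reflected translate of a set of finite measure has finite measure, so the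
indicator of its intersection with any measurable set is integrable. -/
theorem integrable_indicator_preimage_sub_inter {d : ℕ} {U W : Set (EuclideanSpace ℝ (Fin d))}
    (hU : MeasurableSet U) (hUf : volume U ≠ ⊤) (hW : MeasurableSet W)
    (a : EuclideanSpace ℝ (Fin d)) :
    Integrable ((((a - ·) ⁻¹' U) ∩ W).indicator (1 : EuclideanSpace ℝ (Fin d) → ℝ)) := by
  have hm : MeasurableSet ((a - ·) ⁻¹' U) := hU.preimage (measurable_id.const_sub a)
  refine (integrable_indicator_iff (hm.inter hW)).2 (integrableOn_const ?_)
  refine measure_ne_top_of_subset inter_subset_left ?_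
  rwa [(Measure.measurePreserving_sub_left volume a).measure_preimage hU.nullMeasurableSet]

/-- Additive relation between superlevel sets:
`S_{U,V}(α₁) − S_{U,V}(α₂) ⊆ S_{U,−U}(α₁ + α₂ − |V|)`. -/
theorem superlevel_difference_subset {d : ℕ}
    (U V : Set (EuclideanSpace ℝ (Fin d)))
    (hU : MeasurableSet U) (hV : MeasurableSet V)
    (hUf : volume U ≠ ⊤) (hVf : volume V ≠ ⊤)
    (α₁ α₂ : ℝ) (h₁ : 0 < α₁) (h₂ : 0 < α₂) :
    slevE U V α₁ - slevE U V α₂ ⊆ slevE U (-U) (α₁ + α₂ - (volume V).toReal) := by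
  rintro _ ⟨a, ha, b, hb, rfl⟩
  have hab : ((fun v => a - b - (a - v)) ⁻¹' (-U)) = (b - ·) ⁻¹' U := by
    ext v
    simp
  have hself : ∀ x : EuclideanSpace ℝ (Fin d), ((fun v => x - (x - v)) ⁻¹' V) = V := by
    intro x
    simp
  have hVint : Integrable (V.indicator (1 : EuclideanSpace ℝ (Fin d) → ℝ)) :=
    (integrable_indicator_iff hV).2 (integrableOn_const hVf)
  have hVol : (volume V).toReal = ∫ v, V.indicator (1 : EuclideanSpace ℝ (Fin d) → ℝ) v :=
    (integral_indicator_one hV).symm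
  have hae := integrable_indicator_preimage_sub_inter hU hUf hV a
  have hbe := integrable_indicator_preimage_sub_inter hU hUf hV b
  have hUb : MeasurableSet ((b - ·) ⁻¹' U) := hU.preimage (measurable_id.const_sub b)
  have key : cvE U V a + cvE U V b - (volume V).toReal ≤ cvE U (-U) (a - b) := by
    rw [cvE_eq_integral_indicator_inter U V a a, cvE_eq_integral_indicator_inter U V b b,
      cvE_eq_integral_indicator_inter U (-U) a (a - b), hab, hself, hself, hVol,
      ← integral_add' hae hbe, ← integral_sub' (hae.add hbe) hVint]
    refine integral_mono ((hae.add hbe).sub hVint)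
      (integrable_indicator_preimage_sub_inter hU hUf hUb a) fun v => ?_
    by_cases hv : v ∈ V <;> by_cases hav : a - v ∈ U <;> by_cases hbv : b - v ∈ U <;>
      simp [indicator, hv, hav, hbv]
  simp only [slevE, mem_ofPred_eq] at ha hb ⊢
  linarith
end
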